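/- Let (P_t)_{t≥0} be a Markov–Feller semigroup on a Polish space X. Then the following are equivalent: (1) (P_t) is weakly-* mean ergodic (with unique invariant probability measure μ); (2) (P_t) is Cesàro eventually continuous on X and there exists z ∈ X such that for every ε > 0, inf_{x ∈ X} limsup_{t→∞} Q_t(x, B(z, ε)) > 0. -/

import Mathlib

open MeasureTheory Filter Metric Set Topology
open scoped ENNReal

/-- A Markov–Feller semigroup on a metric measurable space `X`: a family of Markov
kernels `P t` (for `t ≥ 0`) such that `P 0` is the identity kernel, the
Chapman–Kolmogorov semigroup property holds, `x ↦ ∫ f d(P t x)` is continuous for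
every bounded continuous `f` (Feller property), and `t ↦ ∫ f d(P t x)` is Borel
measurable. -/
structure MarkovFellerSemigroup (X : Type*) [MetricSpace X] [MeasurableSpace X]
    [BorelSpace X] where
  P : ℝ → X → Measure X
  isProb : ∀ t, 0 ≤ t → ∀ x, IsProbabilityMeasure (P t x)
  measurable_x : ∀ t, 0 ≤ t → Measurable (P t)
  id0 : ∀ x, P 0 x = Measure.dirac x
  semigroup : ∀ s t : ℝ, 0 ≤ s → 0 ≤ t → ∀ x, P (t + s) x = (P t x).bind (P s)
  feller : ∀ (f : BoundedContinuousFunction X ℝ) (t : ℝ), 0 ≤ t →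
    Continuous fun x => ∫ y, f y ∂ P t x
  measurable_t : ∀ (f : BoundedContinuousFunction X ℝ) (x : X),
    Measurable fun t : ℝ => ∫ y, f y ∂ P t x

namespace MarkovFellerSemigroup

variable {X : Type*} [MetricSpace X] [MeasurableSpace X] [BorelSpace X]

/-- `P_t f (x) = ∫ f(y) P_t(x, dy)`. -/
noncomputable def Pf (S : MarkovFellerSemigroup X) (t : ℝ) (f : X → ℝ) (x : X) : ℝ :=
  ∫ y, f y ∂ S.P t x

/-- The Cesàro average `Q_t f (x) = (1/t) ∫_0^t P_s f (x) ds`. -/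
noncomputable def Qf (S : MarkovFellerSemigroup X) (t : ℝ) (f : X → ℝ) (x : X) : ℝ :=
  (1 / t) * ∫ s in (0:ℝ)..t, S.Pf s f x

/-- The Cesàro average `Q_t(x, A) = (1/t) ∫_0^t P_s(x, A) ds`. -/
noncomputable def Qmeas (S : MarkovFellerSemigroup X) (t : ℝ) (x : X) (A : Set X) : ℝ :=
  (1 / t) * ∫ s in (0:ℝ)..t, (S.P s x A).toReal

/-- The action `P_t μ = ∫ P_t(x, ·) μ(dx)` of the semigroup on measures. -/
noncomputable def Pmeas (S : MarkovFellerSemigroup X) (t : ℝ) (μ : Measure X) : Measure X :=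
  μ.bind (S.P t)

/-- `⟨f, Q_t μ⟩ = (1/t) ∫_0^t ⟨f, P_s μ⟩ ds`. -/
noncomputable def QfM (S : MarkovFellerSemigroup X) (t : ℝ) (f : X → ℝ) (μ : Measure X) : ℝ :=
  (1 / t) * ∫ s in (0:ℝ)..t, ∫ x, S.Pf s f x ∂μ

/-- The set `T` of points `x` for which the family `{Q_t(x,·)}_{t>0}` is tight. -/
def Tset (S : MarkovFellerSemigroup X) : Set X :=
  {x | ∀ ε > (0:ℝ), ∃ K : Set X, IsCompact K ∧ ∀ t > (0:ℝ), 1 - ε ≤ S.Qmeas t x K}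

/-- Bounded Lipschitz real-valued functions, the class `L_b(X)`. -/
def IsBddLipschitz (f : X → ℝ) : Prop :=
  (∃ K, LipschitzWith K f) ∧ ∃ M, ∀ x, |f x| ≤ M

/-- Eventual continuity at `z`: for every bounded Lipschitz `f`,
`limsup_{x → z} limsup_{t → ∞} |P_t f(x) − P_t f(z)| = 0`. -/
def EvContAt (S : MarkovFellerSemigroup X) (z : X) : Prop :=
  ∀ f : X → ℝ, IsBddLipschitz f →
    limsup (fun x => limsup (fun t => |S.Pf t f x - S.Pf t f z|) atTop) (𝓝 z) = 0

/-- Cesàro eventual continuity at `z`: for every bounded Lipschitz `f`,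
`limsup_{x → z} limsup_{t → ∞} |Q_t f(x) − Q_t f(z)| = 0`. -/
def CesaroEvContAt (S : MarkovFellerSemigroup X) (z : X) : Prop :=
  ∀ f : X → ℝ, IsBddLipschitz f →
    limsup (fun x => limsup (fun t => |S.Qf t f x - S.Qf t f z|) atTop) (𝓝 z) = 0

/-- An invariant probability measure of the semigroup. -/
def Invariant (S : MarkovFellerSemigroup X) (μ : Measure X) : Prop :=
  IsProbabilityMeasure μ ∧ ∀ t, 0 ≤ t → S.Pmeas t μ = μ

/-- An ergodic invariant probability measure: an invariant probability measure `μ`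
such that whenever `μ = (1/2)(μ₁ + μ₂)` with `μ₁, μ₂` invariant probability
measures, `μ₁ = μ₂ = μ`. -/
def ErgodicInv (S : MarkovFellerSemigroup X) (μ : Measure X) : Prop :=
  S.Invariant μ ∧ ∀ μ₁ μ₂ : Measure X, S.Invariant μ₁ → S.Invariant μ₂ →
    μ = (2 : ℝ≥0∞)⁻¹ • (μ₁ + μ₂) → μ₁ = μ ∧ μ₂ = μ

/-- The support of a measure: points all of whose balls have positive measure. -/
def msupp (μ : Measure X) : Set X :=
  {x | ∀ ε > (0:ℝ), 0 < μ (ball x ε)}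

/-- `Q_t(x,·)` converges weakly to `μ` as `t → ∞`. -/
def QWeakLim (S : MarkovFellerSemigroup X) (x : X) (μ : Measure X) : Prop :=
  ∀ f : BoundedContinuousFunction X ℝ,
    Tendsto (fun t => S.Qf t f x) atTop (𝓝 (∫ y, f y ∂μ))

/-- `Q_t ν` converges weakly to `μ` as `t → ∞`. -/
def QWeakLimM (S : MarkovFellerSemigroup X) (ν : Measure X) (μ : Measure X) : Prop :=
  ∀ f : BoundedContinuousFunction X ℝ,
    Tendsto (fun t => S.QfM t f ν) atTop (𝓝 (∫ y, f y ∂μ))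

end MarkovFellerSemigroup

namespace MarkovFellerSemigroup

variable {X : Type*} [MetricSpace X] [CompleteSpace X]
  [TopologicalSpace.SeparableSpace X] [MeasurableSpace X] [BorelSpace X]

/-- Weak-* mean ergodicity: there is a unique invariant probability measure `μ*`
and `Q_t μ` converges weakly to `μ*` for every probability measure `μ`. -/
def WeakStarMeanErgodic (S : MarkovFellerSemigroup X) : Prop :=
  ∃ μs : Measure X, S.Invariant μs ∧ (∀ ν : Measure X, S.Invariant ν → ν = μs) ∧
    ∀ μ : Measure X, IsProbabilityMeasure μ → S.QWeakLimM μ μs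

set_option linter.unusedSectionVars false

open ProbabilityTheory in
/-- Integration against a mixture of probability measures. -/
theorem aux_integral_bind {α β : Type*} [MeasurableSpace α] [MeasurableSpace β]
    (m : Measure α) [IsFiniteMeasure m] (κ : Kernel α β) [IsFiniteKernel κ]
    {f : β → ℝ} (hf : Integrable f (m.bind κ)) :
    ∫ y, f y ∂(m.bind κ) = ∫ x, ∫ y, f y ∂(κ x) ∂m := by
  have h := Kernel.integral_comp (κ := Kernel.const Unit m) (η := κ) (a := ()) (f := f)
    (by simpa [Kernel.comp_apply] using hf)
  simpa [Kernel.comp_apply] using h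

/-- Boundedness and continuity of a function. -/
def BC (f : X → ℝ) (M : ℝ) : Prop := Continuous f ∧ ∀ x, |f x| ≤ M

theorem BC.integrable {f : X → ℝ} {M : ℝ} (h : BC f M) (μ : Measure X) [IsFiniteMeasure μ] :
    Integrable f μ :=
  Integrable.of_bound h.1.measurable.aestronglyMeasurable M (Eventually.of_forall h.2)

/-- Bundled version. -/
noncomputable def BC.bcf {f : X → ℝ} {M : ℝ} (h : BC f M) : BoundedContinuousFunction X ℝ :=
  BoundedContinuousFunction.ofNormedAddCommGroup f h.1 M h.2

theorem measurable_KK (S : MarkovFellerSemigroup X) :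
    Measurable (fun p : ℝ × X => S.P (max p.1 0) p.2) := by
  have : SecondCountableTopology X := UniformSpace.secondCountable_of_separable X
  have hp : ∀ p : ℝ × X, IsProbabilityMeasure (S.P (max p.1 0) p.2) := fun p =>
    S.isProb _ (le_max_right _ _) _
  have hcont : ∀ f : BoundedContinuousFunction X ℝ,
      Measurable (fun p : ℝ × X => ∫ y, f y ∂ S.P (max p.1 0) p.2) := by
    intro f
    have h := measurable_uncurry_of_continuous_of_measurable
      (u := fun (x : X) (s : ℝ) => ∫ y, f y ∂ S.P (max s 0) x)
      (fun s => S.feller f _ (le_max_right _ _))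
      (fun x => (S.measurable_t f x).comp (measurable_id.max measurable_const))
    exact h.comp measurable_swap
  refine Measurable.measure_of_isPiSystem_of_isProbabilityMeasure
    (S := {s | IsClosed s}) ?_ ?_ ?_
  · rw [BorelSpace.measurable_eq (α := X), borel_eq_generateFrom_isClosed]
  · intro s hs t ht _
    exact IsClosed.inter hs ht
  · intro F hF
    have hF : IsClosed F := hF
    refine ENNReal.measurable_of_tendsto (f := fun n (p : ℝ × X) =>
      ∫⁻ y, (hF.apprSeq n y : ℝ≥0∞) ∂ S.P (max p.1 0) p.2) ?_ ?_
    · intro n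
      have h1 := hcont ⟨⟨fun x => (hF.apprSeq n x : ℝ),
        NNReal.continuous_coe.comp (hF.apprSeq n).continuous⟩, (hF.apprSeq n).map_bounded'⟩
      have h2 := ENNReal.measurable_ofReal.comp h1
      convert h2 using 1
      ext p
      have := hp p
      have h3 := (hF.apprSeq n).toReal_lintegral_coe_eq_integral (S.P (max p.1 0) p.2)
      simp only [Function.comp]
      have h4 : ∫ y, (hF.apprSeq n y : ℝ) ∂ S.P (max p.1 0) p.2 = _ := h3.symm
      change _ = ENNReal.ofReal (∫ y, (hF.apprSeq n y : ℝ) ∂ S.P (max p.1 0) p.2)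
      rw [h4, ENNReal.ofReal_toReal]
      exact (BoundedContinuousFunction.lintegral_lt_top_of_nnreal _ _).ne
    · rw [tendsto_pi_nhds]
      intro p
      have := hp p
      exact HasOuterApproxClosed.tendsto_lintegral_apprSeq hF _

open ProbabilityTheory in
/-- The joint kernel. -/
noncomputable def KK (S : MarkovFellerSemigroup X) : Kernel (ℝ × X) X :=
  ⟨fun p => S.P (max p.1 0) p.2, S.measurable_KK⟩

instance instKK (S : MarkovFellerSemigroup X) : ProbabilityTheory.IsMarkovKernel S.KK :=
  ⟨fun _ => S.isProb _ (le_max_right _ _) _⟩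

/-- Uniform distribution on `(0,T]`. -/
noncomputable def UT (T : ℝ) : Measure ℝ :=
  (ENNReal.ofReal T)⁻¹ • (volume.restrict (Ioc 0 T))

theorem UT_prob {T : ℝ} (hT : 0 < T) : IsProbabilityMeasure (UT T) := by
  constructor
  simp only [UT, Measure.smul_apply, Measure.restrict_apply MeasurableSet.univ, univ_inter,
    Real.volume_Ioc, sub_zero, smul_eq_mul]
  exact ENNReal.inv_mul_cancel (by simpa using hT) (by simp)

theorem UT_integral {T : ℝ} (hT : 0 < T) (g : ℝ → ℝ) :
    ∫ s, g s ∂(UT T) = (1 / T) * ∫ s in (0:ℝ)..T, g s := by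
  rw [UT, integral_smul_measure, intervalIntegral.integral_of_le hT.le]
  simp [hT.le]

/-- The measure `Q_T ν`. -/
noncomputable def QM (S : MarkovFellerSemigroup X) (T : ℝ) (ν : Measure X) : Measure X :=
  ((UT T).prod ν).bind S.KK

theorem QM_prob (S : MarkovFellerSemigroup X) {T : ℝ} (hT : 0 < T) (ν : Measure X)
    [IsProbabilityMeasure ν] : IsProbabilityMeasure (S.QM T ν) := by
  have := UT_prob hT
  unfold QM
  infer_instance

theorem integrable_KK (S : MarkovFellerSemigroup X) {f : X → ℝ} (hf : Measurable f) {M : ℝ}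
    (hM : ∀ x, |f x| ≤ M) (m : Measure (ℝ × X)) [IsFiniteMeasure m] :
    Integrable (fun p => ∫ y, f y ∂ S.KK p) m := by
  refine Integrable.of_bound (C := M)
    (hf.stronglyMeasurable.integral_kernel (κ := S.KK)).aestronglyMeasurable ?_
  refine Eventually.of_forall fun p => ?_
  have := norm_integral_le_of_norm_le_const (μ := S.KK p) (f := f) (C := M) (Eventually.of_forall hM)
  simpa using this

theorem setInt_max (S : MarkovFellerSemigroup X) (G : Measure X → ℝ) (x : X) {T : ℝ} (hT : 0 < T) :
    ∫ s in (0:ℝ)..T, G (S.P (max s 0) x) = ∫ s in (0:ℝ)..T, G (S.P s x) := by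
  refine intervalIntegral.integral_congr fun s hs => ?_
  rw [uIcc_of_le hT.le] at hs
  simp [max_eq_left hs.1]

theorem integral_QM (S : MarkovFellerSemigroup X) {f : X → ℝ} (hf : Measurable f) {M : ℝ}
    (hM : ∀ x, |f x| ≤ M) {T : ℝ} (hT : 0 < T) (ν : Measure X) [IsProbabilityMeasure ν] :
    ∫ y, f y ∂(S.QM T ν) = S.QfM T f ν := by
  have := UT_prob hT
  have := S.QM_prob hT ν
  have hi : Integrable f (((UT T).prod ν).bind S.KK) :=
    Integrable.of_bound (μ := S.QM T ν) hf.aestronglyMeasurable M (Eventually.of_forall hM)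
  rw [QM, aux_integral_bind _ _ hi, integral_prod _ (S.integrable_KK hf hM _), UT_integral hT,
    QfM]
  congr 1
  refine intervalIntegral.integral_congr fun s hs => ?_
  rw [uIcc_of_le hT.le] at hs
  simp only [KK, Pf, ProbabilityTheory.Kernel.coe_mk, max_eq_left hs.1]

theorem QfM_eq (S : MarkovFellerSemigroup X) {f : X → ℝ} (hf : Measurable f) {M : ℝ}
    (hM : ∀ x, |f x| ≤ M) {T : ℝ} (hT : 0 < T) (ν : Measure X) [IsProbabilityMeasure ν] :
    S.QfM T f ν = ∫ x, S.Qf T f x ∂ν := by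
  have := UT_prob hT
  have := S.QM_prob hT ν
  have hi : Integrable f (((UT T).prod ν).bind S.KK) :=
    Integrable.of_bound (μ := S.QM T ν) hf.aestronglyMeasurable M (Eventually.of_forall hM)
  rw [← S.integral_QM hf hM hT ν, QM, aux_integral_bind _ _ hi,
    integral_prod_symm _ (S.integrable_KK hf hM _)]
  congr 1
  ext x
  rw [UT_integral hT, Qf]
  congr 1
  exact S.setInt_max (fun μ => ∫ y, f y ∂μ) x hT

theorem QfM_dirac (S : MarkovFellerSemigroup X) {f : X → ℝ} (hf : Measurable f) {M : ℝ}
    (hM : ∀ x, |f x| ≤ M) {T : ℝ} (hT : 0 < T) (x : X) :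
    S.QfM T f (Measure.dirac x) = S.Qf T f x := by
  rw [S.QfM_eq hf hM hT, integral_dirac]

/-- The measure `Q_T(x,·)`. -/
noncomputable def Qx (S : MarkovFellerSemigroup X) (T : ℝ) (x : X) : Measure X :=
  S.QM T (Measure.dirac x)

theorem Qx_prob (S : MarkovFellerSemigroup X) {T : ℝ} (hT : 0 < T) (x : X) :
    IsProbabilityMeasure (S.Qx T x) := S.QM_prob hT _

theorem integral_Qx (S : MarkovFellerSemigroup X) {f : X → ℝ} (hf : Measurable f) {M : ℝ}
    (hM : ∀ x, |f x| ≤ M) {T : ℝ} (hT : 0 < T) (x : X) :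
    ∫ y, f y ∂(S.Qx T x) = S.Qf T f x := by
  rw [Qx, S.integral_QM hf hM hT, S.QfM_dirac hf hM hT]

theorem Qmeas_eq (S : MarkovFellerSemigroup X) {A : Set X} (hA : MeasurableSet A)
    {T : ℝ} (hT : 0 < T) (x : X) : S.Qmeas T x A = (S.Qx T x).real A := by
  have h := S.integral_Qx (f := A.indicator 1) (measurable_one.indicator hA) (M := 1)
    (fun x => by by_cases h : x ∈ A <;> simp [h]) hT x
  rw [integral_indicator_one hA] at h
  rw [h, Qmeas, Qf]
  congr 1
  refine intervalIntegral.integral_congr fun s hs => ?_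
  simp only [Pf]
  rw [integral_indicator_one hA]
  rfl

/-- Time path of `P_s f(x)`, extended to negative times. -/
noncomputable def psi (S : MarkovFellerSemigroup X) (f : X → ℝ) (x : X) (s : ℝ) : ℝ :=
  S.Pf (max s 0) f x

theorem Pf_bound (S : MarkovFellerSemigroup X) {f : X → ℝ} {M : ℝ}
    (hM : ∀ x, |f x| ≤ M) {s : ℝ} (hs : 0 ≤ s) (x : X) : |S.Pf s f x| ≤ M := by
  have := S.isProb s hs x
  have := norm_integral_le_of_norm_le_const (μ := S.P s x) (f := f) (C := M) (Eventually.of_forall hM)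
  simpa [Pf] using this

theorem psi_meas (S : MarkovFellerSemigroup X) {f : X → ℝ} {M : ℝ} (h : BC f M) (x : X) :
    Measurable (S.psi f x) :=
  (S.measurable_t h.bcf x).comp (measurable_id.max measurable_const)

theorem psi_bound (S : MarkovFellerSemigroup X) {f : X → ℝ} {M : ℝ} (h : BC f M) (x : X) (s : ℝ) :
    |S.psi f x s| ≤ M := S.Pf_bound h.2 (le_max_right _ _) x

theorem psi_ii (S : MarkovFellerSemigroup X) {f : X → ℝ} {M : ℝ} (h : BC f M) (x : X) (a b : ℝ) :
    IntervalIntegrable (S.psi f x) volume a b := by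
  have h0 : IntervalIntegrable (fun _ => M) volume a b := intervalIntegrable_const
  exact h0.mono_fun' (S.psi_meas h x).aestronglyMeasurable
    (Eventually.of_forall (S.psi_bound h x))

theorem Qf_psi (S : MarkovFellerSemigroup X) (f : X → ℝ) (x : X) {T : ℝ} (hT : 0 < T) :
    S.Qf T f x = (1 / T) * ∫ s in (0:ℝ)..T, S.psi f x s := by
  rw [Qf]
  congr 1
  exact (S.setInt_max (fun μ => ∫ y, f y ∂μ) x hT).symm

theorem BC_Pf (S : MarkovFellerSemigroup X) {f : X → ℝ} {M : ℝ} (h : BC f M) {s : ℝ} (hs : 0 ≤ s) :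
    BC (S.Pf s f) M := ⟨S.feller h.bcf s hs, S.Pf_bound h.2 hs⟩

theorem BC_Qf (S : MarkovFellerSemigroup X) {f : X → ℝ} {M : ℝ} (h : BC f M) {T : ℝ} (hT : 0 < T) :
    BC (S.Qf T f) M := by
  constructor
  · have : S.Qf T f = fun x => (1 / T) * ∫ s in (0:ℝ)..T, S.psi f x s := by
      ext x; exact S.Qf_psi f x hT
    rw [this]
    refine continuous_const.mul ?_
    refine intervalIntegral.continuous_of_dominated_interval (bound := fun _ => M) ?_ ?_ ?_ ?_
    · intro x; exact (S.psi_meas h x).aestronglyMeasurable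
    · intro x; exact Eventually.of_forall fun s _ => S.psi_bound h x s
    · exact intervalIntegrable_const
    · exact Eventually.of_forall fun s _ => (S.BC_Pf h (le_max_right s 0)).1
  · intro x
    rw [S.Qf_psi f x hT, abs_mul, abs_of_pos (by positivity : 0 < 1 / T)]
    have := intervalIntegral.norm_integral_le_of_norm_le_const (a := 0) (b := T)
      (f := S.psi f x) (C := M) (fun s _ => S.psi_bound h x s)
    rw [sub_zero, abs_of_pos hT, Real.norm_eq_abs] at this
    calc 1 / T * |∫ s in (0:ℝ)..T, S.psi f x s| ≤ 1 / T * (M * T) := by gcongr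
      _ = M := by field_simp

theorem Pf_Pf (S : MarkovFellerSemigroup X) {f : X → ℝ} {M : ℝ} (h : BC f M) {s t : ℝ}
    (hs : 0 ≤ s) (ht : 0 ≤ t) (x : X) : S.Pf t (S.Pf s f) x = S.Pf (t + s) f x := by
  have := S.isProb t ht x
  have := S.isProb (t + s) (by positivity) x
  let κ : ProbabilityTheory.Kernel X X := ⟨S.P s, S.measurable_x s hs⟩
  have hκ : ProbabilityTheory.IsMarkovKernel κ := ⟨fun y => S.isProb s hs y⟩
  have hb : S.P (t + s) x = (S.P t x).bind κ := S.semigroup s t hs ht x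
  unfold Pf
  have hi := h.integrable (S.P (t + s) x)
  rw [hb] at hi
  rw [hb, aux_integral_bind _ _ hi]
  rfl

theorem Qf_Pf (S : MarkovFellerSemigroup X) {f : X → ℝ} {M : ℝ} (h : BC f M) {s T : ℝ}
    (hs : 0 ≤ s) (hT : 0 < T) (x : X) :
    S.Qf T (S.Pf s f) x = (1 / T) * ∫ v in (0:ℝ)..T, S.psi f x (s + v) := by
  rw [Qf]
  congr 1
  refine intervalIntegral.integral_congr fun v hv => ?_
  rw [uIcc_of_le hT.le] at hv
  simp only [psi]
  rw [S.Pf_Pf h hs hv.1, max_eq_left (by linarith [hv.1]), add_comm]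

theorem Pf_Qf (S : MarkovFellerSemigroup X) {f : X → ℝ} {M : ℝ} (h : BC f M) {s T : ℝ}
    (hs : 0 ≤ s) (hT : 0 < T) (x : X) :
    S.Pf s (S.Qf T f) x = (1 / T) * ∫ v in (0:ℝ)..T, S.psi f x (s + v) := by
  have := S.isProb s hs x
  rw [Pf, ← S.QfM_eq h.1.measurable h.2 hT, QfM]
  congr 1
  refine intervalIntegral.integral_congr fun v hv => ?_
  rw [uIcc_of_le hT.le] at hv
  simp only [psi]
  rw [max_eq_left (by linarith [hv.1]), ← S.Pf_Pf h hv.1 hs]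
  rfl

theorem shift_est (S : MarkovFellerSemigroup X) {f : X → ℝ} {M : ℝ} (h : BC f M) {s T : ℝ}
    (hs : 0 ≤ s) (hT : 0 < T) (x : X) :
    |(1 / T) * (∫ v in (0:ℝ)..T, S.psi f x (s + v)) - S.Qf T f x| ≤ 2 * s * M / T := by
  rw [S.Qf_psi f x hT, ← mul_sub, intervalIntegral.integral_comp_add_left, add_zero]
  have e : (∫ v in s..(s + T), S.psi f x v) - ∫ v in (0:ℝ)..T, S.psi f x v
      = (∫ v in T..(s + T), S.psi f x v) - ∫ v in (0:ℝ)..s, S.psi f x v := by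
    have h1 := intervalIntegral.integral_add_adjacent_intervals
      (S.psi_ii h x 0 s) (S.psi_ii h x s (s + T))
    have h2 := intervalIntegral.integral_add_adjacent_intervals
      (S.psi_ii h x 0 T) (S.psi_ii h x T (s + T))
    linarith
  rw [e, abs_mul, abs_of_pos (by positivity : 0 < 1 / T)]
  have b1 := intervalIntegral.norm_integral_le_of_norm_le_const (a := T) (b := s + T)
      (f := S.psi f x) (C := M) (fun s _ => S.psi_bound h x s)
  have b2 := intervalIntegral.norm_integral_le_of_norm_le_const (a := 0) (b := s)
      (f := S.psi f x) (C := M) (fun s _ => S.psi_bound h x s)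
  rw [sub_zero, abs_of_nonneg hs] at b2
  rw [add_sub_cancel_right, abs_of_nonneg hs] at b1
  have b3 := (norm_sub_le (∫ v in T..(s + T), S.psi f x v) (∫ v in (0:ℝ)..s, S.psi f x v))
  rw [Real.norm_eq_abs] at b3
  calc _ ≤ 1 / T * (2 * s * M) := by
        gcongr
        linarith
    _ = _ := by ring

theorem Pf_Qf_est (S : MarkovFellerSemigroup X) {f : X → ℝ} {M : ℝ} (h : BC f M) {s T : ℝ}
    (hs : 0 ≤ s) (hT : 0 < T) (x : X) :
    |S.Pf s (S.Qf T f) x - S.Qf T f x| ≤ 2 * s * M / T := by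
  rw [S.Pf_Qf h hs hT]; exact S.shift_est h hs hT x

theorem Qf_Pf_est (S : MarkovFellerSemigroup X) {f : X → ℝ} {M : ℝ} (h : BC f M) {s T : ℝ}
    (hs : 0 ≤ s) (hT : 0 < T) (x : X) :
    |S.Qf T (S.Pf s f) x - S.Qf T f x| ≤ 2 * s * M / T := by
  rw [S.Qf_Pf h hs hT]; exact S.shift_est h hs hT x

theorem Qf_Qf_est (S : MarkovFellerSemigroup X) {f : X → ℝ} {M : ℝ} (h : BC f M) {u T : ℝ}
    (hu : 0 < u) (hT : 0 < T) (x : X) :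
    |S.Qf u (S.Qf T f) x - S.Qf T f x| ≤ 2 * u * M / T := by
  have hM : 0 ≤ M := (abs_nonneg _).trans (h.2 x)
  have e : S.Qf u (S.Qf T f) x - S.Qf T f x
      = (1 / u) * ∫ s in (0:ℝ)..u, (S.psi (S.Qf T f) x s - S.Qf T f x) := by
    rw [intervalIntegral.integral_sub (S.psi_ii (S.BC_Qf h hT) x _ _) intervalIntegrable_const,
      S.Qf_psi _ x hu, intervalIntegral.integral_const]
    simp only [sub_zero, smul_eq_mul]
    field_simp
  rw [e, abs_mul, abs_of_pos (by positivity : 0 < 1 / u)]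
  have b1 := intervalIntegral.norm_integral_le_of_norm_le_const (a := 0) (b := u)
      (f := fun s => S.psi (S.Qf T f) x s - S.Qf T f x) (C := 2 * u * M / T) (fun s hs => by
        rw [uIoc_of_le hu.le] at hs
        rw [psi, max_eq_left hs.1.le]
        refine (S.Pf_Qf_est h hs.1.le hT x).trans ?_
        have := hs.2
        gcongr)
  rw [sub_zero, abs_of_pos hu, Real.norm_eq_abs] at b1
  calc _ ≤ 1 / u * (2 * u * M / T * u) := by gcongr
    _ = _ := by field_simp

theorem Qf_comm (S : MarkovFellerSemigroup X) {f : X → ℝ} {M : ℝ} (h : BC f M) {u T : ℝ}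
    (hu : 0 < u) (hT : 0 < T) (x : X) :
    S.Qf u (S.Qf T f) x = S.Qf T (S.Qf u f) x := by
  have key : ∀ {u T : ℝ}, 0 < u → 0 < T → S.Qf u (S.Qf T f) x
      = (1 / u) * ((1 / T) * ∫ s in (0:ℝ)..u, ∫ v in (0:ℝ)..T, S.psi f x (s + v)) := by
    intro u T hu hT
    have e : (1 / T) * ∫ s in (0:ℝ)..u, ∫ v in (0:ℝ)..T, S.psi f x (s + v)
        = ∫ s in (0:ℝ)..u, (1 / T) * ∫ v in (0:ℝ)..T, S.psi f x (s + v) :=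
      (intervalIntegral.integral_const_mul (1 / T) _).symm
    rw [Qf, e]
    congr 1
    refine intervalIntegral.integral_congr fun s hs => ?_
    rw [uIcc_of_le hu.le] at hs
    exact S.Pf_Qf h hs.1 hT x
  rw [key hu hT, key hT hu, intervalIntegral.integral_of_le hu.le,
    intervalIntegral.integral_of_le hT.le]
  simp only [intervalIntegral.integral_of_le hu.le, intervalIntegral.integral_of_le hT.le]
  rw [integral_integral_swap (f := fun s v => S.psi f x (s + v))]
  · simp only [add_comm]; ring
  · refine Integrable.of_bound (C := M) ?_ (Eventually.of_forall fun p => S.psi_bound h x _)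
    exact ((S.psi_meas h x).comp (measurable_fst.add measurable_snd)).aestronglyMeasurable

theorem Qf_Qf_est' (S : MarkovFellerSemigroup X) {f : X → ℝ} {M : ℝ} (h : BC f M) {u T : ℝ}
    (hu : 0 < u) (hT : 0 < T) (x : X) :
    |S.Qf T (S.Qf u f) x - S.Qf T f x| ≤ 2 * u * M / T := by
  rw [← S.Qf_comm h hu hT]; exact S.Qf_Qf_est h hu hT x

theorem IsBddLipschitz.exBC {f : X → ℝ} (h : IsBddLipschitz f) : ∃ M, BC f M := by
  obtain ⟨⟨K, hK⟩, M, hM⟩ := h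
  exact ⟨M, hK.continuous, hM⟩

theorem Qdiff_bound (S : MarkovFellerSemigroup X) {f : X → ℝ} {M : ℝ} (h : BC f M) (x z : X)
    {T : ℝ} (hT : 0 < T) : |S.Qf T f x - S.Qf T f z| ≤ 2 * M := by
  have h1 := (S.BC_Qf h hT).2 x
  have h2 := (S.BC_Qf h hT).2 z
  have := abs_sub (S.Qf T f x) (S.Qf T f z)
  linarith

theorem evCont_eventually (S : MarkovFellerSemigroup X) {z : X} (hz : S.CesaroEvContAt z)
    {f : X → ℝ} (hf : IsBddLipschitz f) {ε : ℝ} (hε : 0 < ε) :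
    ∀ᶠ x in 𝓝 z, ∀ᶠ t in atTop, |S.Qf t f x - S.Qf t f z| < ε := by
  obtain ⟨M, h⟩ := hf.exBC
  have hb : ∀ x, ∀ᶠ t in (atTop : Filter ℝ), |S.Qf t f x - S.Qf t f z| ≤ 2 * M := by
    intro x
    filter_upwards [eventually_gt_atTop 0] with t ht using S.Qdiff_bound h x z ht
  have hcob : ∀ x, IsCoboundedUnder (· ≤ ·) (atTop : Filter ℝ)
      (fun t => |S.Qf t f x - S.Qf t f z|) := fun x =>
    (isBoundedUnder_of ⟨0, fun t => abs_nonneg _⟩ :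
      IsBoundedUnder (· ≥ ·) (atTop : Filter ℝ) _).isCoboundedUnder_le
  have h0 := hz f hf
  have h1 := eventually_lt_of_limsup_lt (b := ε) (by rw [h0]; exact hε)
    (isBoundedUnder_of ⟨2 * M, fun x => limsup_le_of_le (hcob x) (hb x)⟩)
  filter_upwards [h1] with x hx
  exact eventually_lt_of_limsup_lt hx (isBoundedUnder_of_eventually_le (hb x))

theorem low_frequently (S : MarkovFellerSemigroup X) {x z : X} {ε c : ℝ} (hc : 0 < c)
    (h : c ≤ limsup (fun t => S.Qmeas t x (ball z ε)) atTop) :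
    ∃ᶠ t in atTop, 0 < t ∧ c / 2 < (S.Qx t x).real (ball z ε) := by
  have hb : ∀ᶠ t in (atTop : Filter ℝ), 0 ≤ S.Qmeas t x (ball z ε) := by
    filter_upwards [eventually_gt_atTop 0] with t ht
    rw [S.Qmeas_eq measurableSet_ball ht]
    exact measureReal_nonneg
  have h1 : ∃ᶠ t in (atTop : Filter ℝ), c / 2 < S.Qmeas t x (ball z ε) := by
    refine frequently_lt_of_lt_limsup ?_ (by linarith)
    exact (isBoundedUnder_of_eventually_ge hb).isCoboundedUnder_le
  refine (h1.and_eventually (eventually_gt_atTop 0)).mono fun t ht => ⟨ht.2, ?_⟩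
  rw [← S.Qmeas_eq measurableSet_ball ht.2]
  exact ht.1

theorem merging (S : MarkovFellerSemigroup X) {z : X} (hz : S.CesaroEvContAt z)
    (hlow : ∀ ε > (0:ℝ), ∃ c > (0:ℝ), ∀ x : X,
          c ≤ limsup (fun t => S.Qmeas t x (ball z ε)) atTop)
    {f : X → ℝ} (hf : IsBddLipschitz f) (x : X) :
    Tendsto (fun t => S.Qf t f x - S.Qf t f z) atTop (𝓝 0) := by
  obtain ⟨M, h⟩ := hf.exBC
  have hM : 0 ≤ M := (abs_nonneg _).trans (h.2 x)
  refine tendsto_of_seq_tendsto fun u hu => ?_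
  let w : ℕ → ℝ := fun n => max (u n) 1
  have hw0 : ∀ n, 0 < w n := fun n => lt_of_lt_of_le one_pos (le_max_right _ _)
  have hwt : Tendsto w atTop atTop := tendsto_atTop_mono (fun n => le_max_left _ _) hu
  have hwu : ∀ᶠ n in atTop, w n = u n := by
    filter_upwards [hu.eventually_ge_atTop 1] with n hn using max_eq_left hn
  let H : ℕ → X → ℝ≥0∞ := fun n x => ENNReal.ofReal |S.Qf (w n) f x - S.Qf (w n) f z|
  let G : X → ℝ≥0∞ := fun x => limsup (fun n => H n x) atTop
  have hHc : ∀ n, Continuous (fun y => |S.Qf (w n) f y - S.Qf (w n) f z|) := fun n =>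
    ((S.BC_Qf h (hw0 n)).1.sub continuous_const).abs
  have hHm : ∀ n, Measurable (H n) := fun n =>
    ENNReal.measurable_ofReal.comp (hHc n).measurable
  have hHb : ∀ n y, H n y ≤ ENNReal.ofReal (2 * M) := fun n y =>
    ENNReal.ofReal_le_ofReal (S.Qdiff_bound h y z (hw0 n))
  have hGb : ∀ y, G y ≤ ENNReal.ofReal (2 * M) := fun y =>
    limsup_le_of_le (by isBoundedDefault) (Eventually.of_forall fun n => hHb n y)
  -- reverse Fatou
  have hstep : ∀ y v, 0 < v → G y ≤ ∫⁻ y', G y' ∂(S.Qx v y) := by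
    intro y v hv
    have := S.Qx_prob hv y
    have h1 : ∀ n, H n y ≤ ∫⁻ y', H n y' ∂(S.Qx v y) + ENNReal.ofReal (2 * v * M / w n) := by
      intro n
      have hbc := S.BC_Qf h (hw0 n)
      have e1 := S.integral_Qx hbc.1.measurable hbc.2 hv y
      have e2 := S.Qf_Qf_est h hv (hw0 n) y
      have hintg : Integrable (fun y' => |S.Qf (w n) f y' - S.Qf (w n) f z|) (S.Qx v y) :=
        ((hbc.integrable _).sub (integrable_const _)).abs
      have e3 : ∫⁻ y', H n y' ∂(S.Qx v y)
          = ENNReal.ofReal (∫ y', |S.Qf (w n) f y' - S.Qf (w n) f z| ∂(S.Qx v y)) :=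
        (ofReal_integral_eq_lintegral_ofReal hintg
          (Eventually.of_forall fun _ => abs_nonneg _)).symm
      rw [e3, ← ENNReal.ofReal_add (integral_nonneg fun _ => abs_nonneg _)
        (by have := hw0 n; positivity)]
      refine ENNReal.ofReal_le_ofReal ?_
      have e4 : S.Qf v (S.Qf (w n) f) y - S.Qf (w n) f z
          = ∫ y', (S.Qf (w n) f y' - S.Qf (w n) f z) ∂(S.Qx v y) := by
        rw [integral_sub (hbc.integrable _) (integrable_const _), e1]
        simp
      have e5 := abs_integral_le_integral_abs (μ := S.Qx v y)
        (f := fun y' => S.Qf (w n) f y' - S.Qf (w n) f z)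
      rw [← e4] at e5
      have e6 := abs_sub_le (S.Qf (w n) f y) (S.Qf v (S.Qf (w n) f) y) (S.Qf (w n) f z)
      rw [abs_sub_comm (S.Qf (w n) f y) (S.Qf v (S.Qf (w n) f) y)] at e6
      linarith
    have h2 : Tendsto (fun n => ENNReal.ofReal (2 * v * M / w n)) atTop (𝓝 0) := by
      have := ENNReal.tendsto_ofReal (hwt.const_div_atTop (2 * v * M))
      simpa using this
    calc G y ≤ limsup (fun n => ∫⁻ y', H n y' ∂(S.Qx v y)
              + ENNReal.ofReal (2 * v * M / w n)) atTop :=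
          limsup_le_limsup (Eventually.of_forall h1)
      _ = limsup (fun n => ∫⁻ y', H n y' ∂(S.Qx v y)) atTop :=
          ENNReal.limsup_add_of_right_tendsto_zero h2 _
      _ ≤ ∫⁻ y', G y' ∂(S.Qx v y) := by
          refine limsup_lintegral_le (fun _ => ENNReal.ofReal (2 * M)) hHm
            (fun n => Eventually.of_forall (hHb n)) ?_
          rw [lintegral_const, measure_univ, mul_one]; exact ENNReal.ofReal_ne_top
  let Ms : ℝ≥0∞ := ⨆ y, G y
  have hMs : Ms ≤ ENNReal.ofReal (2 * M) := iSup_le hGb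
  have hMt : Ms ≠ ∞ := ne_top_of_le_ne_top ENNReal.ofReal_ne_top hMs
  set m := Ms.toReal with hm
  have hMm : Ms = ENNReal.ofReal m := (ENNReal.ofReal_toReal hMt).symm
  have hm0 : 0 ≤ m := ENNReal.toReal_nonneg
  have hsmall : ∀ ε > 0, m ≤ ε := by
    intro ε hε
    by_contra! hlt
    obtain ⟨δ, hδ, hball⟩ := Metric.eventually_nhds_iff_ball.1 (S.evCont_eventually hz hf hε)
    have hGball : ∀ y ∈ ball z δ, G y ≤ ENNReal.ofReal ε := by
      intro y hy
      refine limsup_le_of_le (by isBoundedDefault) ?_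
      filter_upwards [hwt.eventually (hball y hy)] with n hn
      exact ENNReal.ofReal_le_ofReal hn.le
    obtain ⟨c, hc, hcl⟩ := hlow δ hδ
    have hx : ∀ y, G y ≤ ENNReal.ofReal (m - (m - ε) * (c / 2)) := by
      intro y
      obtain ⟨v, hv, hq⟩ := (S.low_frequently hc (hcl y)).exists
      have := S.Qx_prob hv y
      set q := (S.Qx v y).real (ball z δ) with hqd
      have hq1 : q ≤ 1 := measureReal_le_one
      have hq0 : 0 ≤ q := measureReal_nonneg
      calc G y ≤ ∫⁻ y', G y' ∂(S.Qx v y) := hstep y v hv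
        _ = ∫⁻ y' in ball z δ, G y' ∂(S.Qx v y) + ∫⁻ y' in (ball z δ)ᶜ, G y' ∂(S.Qx v y) :=
            (lintegral_add_compl _ measurableSet_ball).symm
        _ ≤ ENNReal.ofReal ε * (S.Qx v y) (ball z δ) + Ms * (S.Qx v y) (ball z δ)ᶜ := by
            gcongr
            · rw [← setLIntegral_const]
              exact setLIntegral_mono measurable_const hGball
            · rw [← setLIntegral_const]
              exact setLIntegral_mono measurable_const fun y _ => le_iSup G y
        _ = ENNReal.ofReal (ε * q + m * (1 - q)) := by
            rw [ENNReal.ofReal_add (by positivity) (mul_nonneg hm0 (by linarith)),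
              ENNReal.ofReal_mul hε.le, ENNReal.ofReal_mul hm0, hMm, hqd, ofReal_measureReal,
              ← probReal_compl_eq_one_sub measurableSet_ball, ofReal_measureReal]
        _ ≤ _ := by
            refine ENNReal.ofReal_le_ofReal ?_
            nlinarith
    have h1 : Ms ≤ ENNReal.ofReal (m - (m - ε) * (c / 2)) := iSup_le hx
    have h2 : ENNReal.ofReal (m - (m - ε) * (c / 2)) < ENNReal.ofReal m := by
      refine (ENNReal.ofReal_lt_ofReal_iff (by linarith)).2 ?_
      have : 0 < (m - ε) * (c / 2) := mul_pos (by linarith) (by linarith)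
      linarith
    rw [hMm] at h1
    exact absurd h2 (not_lt.2 h1)
  rw [Metric.tendsto_nhds]
  intro ε hε
  have h1 : G x < ENNReal.ofReal ε := by
    calc G x ≤ Ms := le_iSup G x
      _ = ENNReal.ofReal m := hMm
      _ ≤ ENNReal.ofReal (ε / 2) := ENNReal.ofReal_le_ofReal (hsmall _ (by positivity))
      _ < _ := (ENNReal.ofReal_lt_ofReal_iff hε).2 (by linarith)
  filter_upwards [eventually_lt_of_limsup_lt h1, hwu] with n hn hwn
  have := (ENNReal.ofReal_lt_ofReal_iff hε).1 hn
  rw [hwn] at this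
  simpa [Real.dist_eq] using this

/-! ### Gliding hump -/

/-- Supremum of a selection of functions. -/
noncomputable def selSup (b : ℕ → X → ℝ) (I : ℕ → Bool) (y : X) : ℝ :=
  ⨆ i, (if I i then b i y else 0)

theorem selSup_bdd {b : ℕ → X → ℝ} {r : ℝ} (h0 : ∀ i y, 0 ≤ b i y) (hr : ∀ i y, b i y ≤ r)
    (I : ℕ → Bool) (y : X) : BddAbove (range fun i => (if I i then b i y else 0)) := by
  refine ⟨r, ?_⟩
  rintro _ ⟨i, rfl⟩
  have := h0 i y
  have := hr i y
  simp only
  split_ifs <;> linarith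

theorem selSup_nonneg {b : ℕ → X → ℝ} (h0 : ∀ i y, 0 ≤ b i y)
    (I : ℕ → Bool) (y : X) : 0 ≤ selSup b I y := by
  refine Real.iSup_nonneg fun i => ?_
  split_ifs
  · exact h0 i y
  · exact le_rfl

theorem selSup_single {b : ℕ → X → ℝ} {r : ℝ} (h0 : ∀ i y, 0 ≤ b i y) (hr : ∀ i y, b i y ≤ r)
    (I : ℕ → Bool) (y : X) (i : ℕ) (hi : ∀ j, j ≠ i → b j y = 0) :
    selSup b I y = if I i then b i y else 0 := by
  refine le_antisymm ?_ (le_ciSup (selSup_bdd h0 hr I y) i)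
  refine ciSup_le fun j => ?_
  by_cases hj : j = i
  · rw [hj]
  · rw [hi j hj, ite_self]
    split_ifs
    · exact h0 i y
    · exact le_rfl

theorem selSup_lip {b : ℕ → X → ℝ} {r : ℝ} (h0 : ∀ i y, 0 ≤ b i y) (hr : ∀ i y, b i y ≤ r)
    (hl : ∀ i, LipschitzWith 1 (b i)) (I : ℕ → Bool) : IsBddLipschitz (selSup b I) := by
  refine ⟨⟨1, ?_⟩, r, fun y => ?_⟩
  · refine LipschitzWith.of_le_add fun y y' => ?_
    refine ciSup_le fun i => ?_
    have h1 := le_ciSup (selSup_bdd h0 hr I y') i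
    have h2 := (hl i).le_add_mul y y'
    simp only [NNReal.coe_one, one_mul] at h2
    have h3 : (if I i then b i y' else 0) ≤ selSup b I y' := h1
    have h4 : 0 ≤ dist y y' := dist_nonneg
    split_ifs at h3 ⊢ <;> linarith
  · rw [abs_of_nonneg (selSup_nonneg h0 I y)]
    refine ciSup_le fun i => ?_
    have := h0 i y
    have := hr i y
    split_ifs <;> linarith

theorem disj_index {b : ℕ → X → ℝ} (hd : ∀ i j y, i ≠ j → b i y = 0 ∨ b j y = 0) (y : X) :
    ∃ i, ∀ j, j ≠ i → b j y = 0 := by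
  by_cases h : ∃ i, b i y ≠ 0
  · obtain ⟨i, hi⟩ := h
    exact ⟨i, fun j hj => (hd j i y hj).resolve_right hi⟩
  · push Not at h
    exact ⟨0, fun j _ => h j⟩

theorem schur (S : MarkovFellerSemigroup X) {z x : X}
    (hmerge : ∀ f, IsBddLipschitz f → Tendsto (fun t => S.Qf t f x - S.Qf t f z) atTop (𝓝 0))
    {b : ℕ → X → ℝ} {r : ℝ} (h0 : ∀ i y, 0 ≤ b i y) (hr : ∀ i y, b i y ≤ r)
    (hl : ∀ i, LipschitzWith 1 (b i)) (hd : ∀ i j y, i ≠ j → b i y = 0 ∨ b j y = 0)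
    {τ : ℕ → ℝ} (hτ0 : ∀ i, 0 < τ i) (hτ : Tendsto τ atTop atTop) {η : ℝ} (hη : 0 < η) :
    ∃ n, ∀ i ≥ n, |S.Qf (τ i) (b i) x - S.Qf (τ i) (b i) z| ≤ η := by
  have hbc : ∀ I, BC (selSup b I) r := by
    intro I
    obtain ⟨⟨K, hK⟩, -⟩ := selSup_lip h0 hr hl I
    refine ⟨hK.continuous, fun y => ?_⟩
    rw [abs_of_nonneg (selSup_nonneg h0 I y)]
    refine ciSup_le fun i => ?_
    have := h0 i y
    have := hr i y
    split_ifs <;> linarith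
  have hcont : ∀ (T : ℝ), 0 < T → ∀ x, Continuous (fun I => S.Qf T (selSup b I) x) := by
    intro T hT x
    have := S.Qx_prob hT x
    have e : (fun I => S.Qf T (selSup b I) x) = fun I => ∫ y, selSup b I y ∂(S.Qx T x) := by
      ext I; exact (S.integral_Qx (hbc I).1.measurable (hbc I).2 hT x).symm
    rw [e]
    refine continuous_of_dominated (bound := fun _ => r) ?_ ?_ (integrable_const _) ?_
    · exact fun I => (hbc I).1.measurable.aestronglyMeasurable
    · exact fun I => Eventually.of_forall (hbc I).2
    · refine Eventually.of_forall fun y => ?_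
      obtain ⟨i, hi⟩ := disj_index hd y
      simp_rw [selSup_single h0 hr _ y i hi]
      have : Continuous (fun c : Bool => if c then b i y else 0) := continuous_of_discreteTopology
      exact this.comp (continuous_apply i)
  let C : ℕ → Set (ℕ → Bool) := fun n =>
    {I | ∀ i ≥ n, |S.Qf (τ i) (selSup b I) x - S.Qf (τ i) (selSup b I) z| ≤ η / 2}
  have hC : ∀ n, IsClosed (C n) := by
    intro n
    have : C n = ⋂ i, ⋂ (_ : i ≥ n),
        {I | |S.Qf (τ i) (selSup b I) x - S.Qf (τ i) (selSup b I) z| ≤ η / 2} := by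
      ext I; simp [C]
    rw [this]
    refine isClosed_iInter fun i => isClosed_iInter fun _ => isClosed_le ?_ continuous_const
    exact ((hcont _ (hτ0 i) x).sub (hcont _ (hτ0 i) z)).abs
  have hU : ⋃ n, C n = univ := by
    refine eq_univ_of_forall fun I => ?_
    have h1 := (hmerge _ (selSup_lip h0 hr hl I)).comp hτ
    have h2 := (Metric.tendsto_atTop.1 h1) (η / 2) (by positivity)
    obtain ⟨n, hn⟩ := h2
    refine mem_iUnion.2 ⟨n, fun i hi => ?_⟩
    have := hn i hi
    rw [Real.dist_eq, sub_zero] at this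
    exact this.le
  obtain ⟨n, I, hI⟩ := nonempty_interior_of_iUnion_of_closed hC hU
  have hnhds : C n ∈ 𝓝 I := mem_interior_iff_mem_nhds.1 hI
  rw [nhds_pi, Filter.mem_pi] at hnhds
  obtain ⟨s, hs, t, ht, hst⟩ := hnhds
  obtain ⟨N, hN⟩ := hs.bddAbove
  refine ⟨max n (N + 1), fun i hi => ?_⟩
  have hin : n ≤ i := (le_max_left _ _).trans hi
  have hiN : i ∉ s := fun h => by
    have := hN h
    have := (le_max_right n (N + 1)).trans hi
    omega
  have hup : ∀ c, Function.update I i c ∈ C n := by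
    intro c
    refine hst fun j hj => ?_
    have : j ≠ i := fun e => hiN (e ▸ hj)
    rw [Function.update_of_ne this]
    exact mem_of_mem_nhds (ht j)
  have hT := hup true i hin
  have hF := hup false i hin
  have hdiff : ∀ y, selSup b (Function.update I i true) y - selSup b (Function.update I i false) y
      = b i y := by
    intro y
    obtain ⟨j, hj⟩ := disj_index hd y
    rw [selSup_single h0 hr _ y j hj, selSup_single h0 hr _ y j hj]
    by_cases hij : j = i
    · subst hij; simp
    · rw [Function.update_of_ne hij, Function.update_of_ne hij, sub_self,
        hj i (fun e => hij e.symm)]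
  have hQ : ∀ x, S.Qf (τ i) (b i) x = S.Qf (τ i) (selSup b (Function.update I i true)) x
      - S.Qf (τ i) (selSup b (Function.update I i false)) x := by
    intro x
    have := S.Qx_prob (hτ0 i) x
    have hbi : ∀ y, |b i y| ≤ r := fun y => by rw [abs_of_nonneg (h0 i y)]; exact hr i y
    rw [← S.integral_Qx (hl i).continuous.measurable hbi (hτ0 i),
      ← S.integral_Qx (hbc _).1.measurable (hbc _).2 (hτ0 i),
      ← S.integral_Qx (hbc _).1.measurable (hbc _).2 (hτ0 i),
      ← integral_sub ((hbc _).integrable _) ((hbc _).integrable _)]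
    congr 1
    ext y
    exact (hdiff y).symm
  rw [hQ x, hQ z]
  rw [abs_le] at hT hF ⊢
  constructor <;> linarith [hT.1, hT.2, hF.1, hF.2]

/-! ### Hat functions and reachable set -/

/-- Hat function at `y` with radius `δ`. -/
noncomputable def hat (y : X) (δ : ℝ) (x : X) : ℝ := max 0 (1 - dist x y / δ)

theorem hat_nonneg (y : X) (δ : ℝ) (x : X) : 0 ≤ hat y δ x := le_max_left _ _

theorem hat_le_one (y : X) {δ : ℝ} (hδ : 0 < δ) (x : X) : hat y δ x ≤ 1 := by
  refine max_le zero_le_one ?_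
  have : 0 ≤ dist x y / δ := by positivity
  linarith

theorem hat_BC (y : X) {δ : ℝ} (hδ : 0 < δ) : BC (hat y δ) 1 := by
  refine ⟨?_, fun x => ?_⟩
  · unfold hat; fun_prop
  · rw [abs_of_nonneg (hat_nonneg _ _ _)]; exact hat_le_one y hδ x

theorem hat_pos_iff (y : X) {δ : ℝ} (hδ : 0 < δ) (x : X) : 0 < hat y δ x ↔ x ∈ ball y δ := by
  rw [hat, lt_max_iff, mem_ball]
  simp only [lt_irrefl, false_or, sub_pos]
  rw [div_lt_one hδ]

theorem hat_zero (y : X) {δ : ℝ} (hδ : 0 < δ) {x : X} (hx : x ∉ ball y δ) : hat y δ x = 0 :=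
  le_antisymm (not_lt.1 fun h => hx ((hat_pos_iff y hδ x).1 h)) (hat_nonneg _ _ _)

theorem hat_integral_pos (y : X) {δ : ℝ} (hδ : 0 < δ) (ν : Measure X) [IsProbabilityMeasure ν]
    (h : 0 < ν (ball y δ)) : 0 < ∫ x, hat y δ x ∂ν := by
  rw [integral_pos_iff_support_of_nonneg (hat_nonneg y δ) ((hat_BC y hδ).integrable ν)]
  have : Function.support (hat y δ) = ball y δ := by
    ext x
    rw [← hat_pos_iff y hδ, Function.mem_support]
    exact ⟨fun h => lt_of_le_of_ne (hat_nonneg _ _ _) h.symm, fun h => h.ne'⟩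
  rwa [this]

/-- Points reachable from `z`. -/
def reach (S : MarkovFellerSemigroup X) (z : X) : Set X :=
  {y | ∀ δ > (0:ℝ), ∃ s, 0 ≤ s ∧ 0 < S.P s z (ball y δ)}

theorem mem_reach (S : MarkovFellerSemigroup X) (z : X) : z ∈ S.reach z := by
  intro δ hδ
  refine ⟨0, le_rfl, ?_⟩
  rw [S.id0, Measure.dirac_apply' _ measurableSet_ball]
  simp [hδ]

theorem reach_closed (S : MarkovFellerSemigroup X) (z : X) : IsClosed (S.reach z) := by
  refine isClosed_of_closure_subset fun y hy δ hδ => ?_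
  obtain ⟨y', hy', hd⟩ := Metric.mem_closure_iff.1 hy (δ / 2) (by positivity)
  obtain ⟨s, hs, hp⟩ := hy' (δ / 2) (by positivity)
  refine ⟨s, hs, hp.trans_le (measure_mono ?_)⟩
  refine ball_subset_ball' ?_
  rw [dist_comm]; linarith

theorem reach_null (S : MarkovFellerSemigroup X) (z : X) {s : ℝ} (hs : 0 ≤ s) :
    S.P s z (S.reach z)ᶜ = 0 := by
  have : SecondCountableTopology X := UniformSpace.secondCountable_of_separable X
  refine measure_null_of_locally_null _ fun y hy => ?_
  simp only [reach, mem_compl_iff, mem_ofPred_eq] at hy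
  push Not at hy
  obtain ⟨δ, hδ, h⟩ := hy
  exact ⟨ball y δ, mem_nhdsWithin_of_mem_nhds (ball_mem_nhds y hδ),
    le_antisymm (h s hs) zero_le⟩

theorem Qf_Pf_mono (S : MarkovFellerSemigroup X) {z : X} {g h : X → ℝ} {M M' : ℝ} (hg : BC g M)
    (hh : BC h M') (hle : ∀ y ∈ S.reach z, g y ≤ h y) {s T : ℝ} (hs : 0 ≤ s) (hT : 0 < T) :
    S.Qf T (S.Pf s g) z ≤ S.Qf T (S.Pf s h) z := by
  rw [S.Qf_psi _ _ hT, S.Qf_psi _ _ hT]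
  refine mul_le_mul_of_nonneg_left ?_ (by positivity)
  refine intervalIntegral.integral_mono_on hT.le (S.psi_ii (S.BC_Pf hg hs) z _ _)
    (S.psi_ii (S.BC_Pf hh hs) z _ _) fun v hv => ?_
  have hv' : (0:ℝ) ≤ max v 0 := le_max_right _ _
  simp only [psi]
  rw [S.Pf_Pf hg hs hv', S.Pf_Pf hh hs hv']
  have := S.isProb (max v 0 + s) (by positivity) z
  refine integral_mono_ae (hg.integrable _) (hh.integrable _) ?_
  have h0 := S.reach_null z (s := max v 0 + s) (by positivity)
  filter_upwards [measure_eq_zero_iff_ae_notMem.1 h0] with y hy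
  exact hle y (not_not.1 hy)

theorem hump (S : MarkovFellerSemigroup X) {z : X}
    (hz : S.CesaroEvContAt z)
    (hlow : ∀ ε > (0:ℝ), ∃ c > (0:ℝ), ∀ x : X,
          c ≤ limsup (fun t => S.Qmeas t x (ball z ε)) atTop)
    {b : ℕ → X → ℝ} {r : ℝ} (h0 : ∀ i y, 0 ≤ b i y) (hr : ∀ i y, b i y ≤ r)
    (hl : ∀ i, LipschitzWith 1 (b i)) (hd : ∀ i j y, i ≠ j → b i y = 0 ∨ b j y = 0)
    {τ : ℕ → ℝ} (hτ0 : ∀ i, 0 < τ i) (hτ : Tendsto τ atTop atTop) {κ : ℝ} (hκ : 0 < κ)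
    (hbig : ∀ i, 2 * κ ≤ S.Qf (τ i) (b i) z) : False := by
  have hbc : ∀ i, BC (b i) r := fun i => ⟨(hl i).continuous, fun y => by
    rw [abs_of_nonneg (h0 i y)]; exact hr i y⟩
  have hr0 : 0 ≤ r := (h0 0 z).trans (hr 0 z)
  have hpt : ∀ x, ∃ n, ∀ i ≥ n, κ ≤ S.Qf (τ i) (b i) x := by
    intro x
    obtain ⟨n, hn⟩ := S.schur (x := x) (fun f hf => S.merging hz hlow hf x) h0 hr hl hd hτ0 hτ hκ
    refine ⟨n, fun i hi => ?_⟩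
    have := (abs_le.1 (hn i hi)).1
    linarith [hbig i]
  have hcl := S.reach_closed z
  have : CompleteSpace (S.reach z) := hcl.completeSpace_coe
  have : Nonempty (S.reach z) := ⟨⟨z, S.mem_reach z⟩⟩
  let F : ℕ → Set (S.reach z) := fun n => {y | ∀ i ≥ n, κ ≤ S.Qf (τ i) (b i) y}
  have hF : ∀ n, IsClosed (F n) := by
    intro n
    have : F n = ⋂ i, ⋂ (_ : i ≥ n), {y : S.reach z | κ ≤ S.Qf (τ i) (b i) y} := by
      ext y; simp [F]
    rw [this]
    refine isClosed_iInter fun i => isClosed_iInter fun _ => isClosed_le continuous_const ?_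
    exact (S.BC_Qf (hbc i) (hτ0 i)).1.comp continuous_subtype_val
  have hU : ⋃ n, F n = univ := eq_univ_of_forall fun y => mem_iUnion.2 (hpt y)
  obtain ⟨n, y, hy⟩ := nonempty_interior_of_iUnion_of_closed hF hU
  obtain ⟨δ, hδ, hball⟩ := Metric.mem_nhds_iff.1 (mem_interior_iff_mem_nhds.1 hy)
  obtain ⟨s, hs, hp⟩ := y.2 δ hδ
  have hPs := S.isProb s hs z
  let g : X → ℝ := fun x => κ * hat (y : X) δ x
  have hgBC : BC g κ := by
    refine ⟨continuous_const.mul (hat_BC _ hδ).1, fun x => ?_⟩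
    have h1 := hat_nonneg (y : X) δ x
    have h2 := hat_le_one (y : X) hδ x
    rw [abs_of_nonneg (mul_nonneg hκ.le h1)]
    nlinarith
  have hg0 : ∀ x, 0 ≤ g x := fun x => mul_nonneg hκ.le (hat_nonneg _ _ _)
  have hgle : ∀ i ≥ n, ∀ x ∈ S.reach z, g x ≤ S.Qf (τ i) (b i) x := by
    intro i hi x hx
    by_cases hxb : x ∈ ball (y : X) δ
    · have h1 : κ ≤ S.Qf (τ i) (b i) x := hball (a := ⟨x, hx⟩) hxb i hi
      refine le_trans ?_ h1
      have h2 := hat_le_one (y : X) hδ x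
      simp only [g]; nlinarith
    · simp only [g]
      rw [hat_zero _ hδ hxb, mul_zero]
      have := S.Qx_prob (hτ0 i) x
      rw [← S.integral_Qx (hbc i).1.measurable (hbc i).2 (hτ0 i)]
      exact integral_nonneg (h0 i)
  set a := S.Pf s g z with ha
  have ha0 : 0 < a := by
    rw [ha, Pf]
    simp only [g]
    rw [integral_const_mul]
    exact mul_pos hκ (hat_integral_pos _ hδ _ hp)
  have hPBC := S.BC_Pf hgBC hs
  have hP0 : ∀ x, 0 ≤ S.Pf s g x := fun x => integral_nonneg hg0
  have hev : ∀ᶠ x in 𝓝 z, a / 2 < S.Pf s g x :=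
    hPBC.1.continuousAt.eventually (lt_mem_nhds (by linarith : a / 2 < a))
  obtain ⟨δ', hδ', hball'⟩ := Metric.eventually_nhds_iff_ball.1 hev
  obtain ⟨c, hc, hcl⟩ := hlow δ' hδ'
  set β := a / 2 * (c / 2) with hβ
  have hβ0 : 0 < β := by positivity
  have hfr : ∃ᶠ T in atTop, 0 < T ∧ β ≤ S.Qf T (S.Pf s g) z := by
    refine (S.low_frequently hc (hcl z)).mono fun T hT => ⟨hT.1, ?_⟩
    have := S.Qx_prob hT.1 z
    rw [← S.integral_Qx hPBC.1.measurable hPBC.2 hT.1]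
    have h1 : ∫ x, (ball z δ').indicator (fun _ => a / 2) x ∂(S.Qx T z)
        ≤ ∫ x, S.Pf s g x ∂(S.Qx T z) := by
      refine integral_mono ((integrable_const _).indicator measurableSet_ball)
        (hPBC.integrable _) fun x => ?_
      by_cases hx : x ∈ ball z δ'
      · rw [indicator_of_mem hx]; exact (hball' x hx).le
      · rw [indicator_of_notMem hx]; exact hP0 x
    rw [integral_indicator_const _ measurableSet_ball, smul_eq_mul] at h1
    nlinarith [hT.2]
  obtain ⟨N, hN⟩ := exists_nat_gt ((r + 1) / β)
  rw [div_lt_iff₀ hβ0] at hN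
  have herr : Tendsto (fun T : ℝ => ∑ i ∈ Finset.range N,
      (2 * s * r / T + 2 * τ (n + i) * r / T)) atTop (𝓝 0) := by
    have := tendsto_finsetSum (Finset.range N) fun i _ =>
      ((tendsto_id (α := ℝ) (x := atTop)).const_div_atTop (2 * s * r)).add
        ((tendsto_id (α := ℝ) (x := atTop)).const_div_atTop (2 * τ (n + i) * r))
    simpa using this
  obtain ⟨T, ⟨hT, hTβ⟩, hTe⟩ := (hfr.and_eventually (herr.eventually (gt_mem_nhds one_pos))).exists
  have hprob := S.Qx_prob hT z
  have hone : ∀ i, β ≤ S.Qf T (b (n + i)) z + (2 * s * r / T + 2 * τ (n + i) * r / T) := by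
    intro i
    have h1 := S.Qf_Pf_mono hgBC (S.BC_Qf (hbc (n + i)) (hτ0 (n + i)))
      (hgle (n + i) (Nat.le_add_right _ _)) hs hT
    have h2 := (abs_le.1 (S.Qf_Pf_est (S.BC_Qf (hbc (n + i)) (hτ0 (n + i))) hs hT z)).2
    have h3 := (abs_le.1 (S.Qf_Qf_est' (hbc (n + i)) (hτ0 (n + i)) hT z)).2
    linarith
  have hsum : ∑ i ∈ Finset.range N, S.Qf T (b (n + i)) z ≤ r := by
    have e : ∑ i ∈ Finset.range N, S.Qf T (b (n + i)) z
        = ∫ x, ∑ i ∈ Finset.range N, b (n + i) x ∂(S.Qx T z) := by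
      rw [integral_finsetSum _ fun i _ => (hbc (n + i)).integrable _]
      refine Finset.sum_congr rfl fun i _ => ?_
      rw [S.integral_Qx (hbc _).1.measurable (hbc _).2 hT]
    rw [e]
    have h1 : ∫ x, ∑ i ∈ Finset.range N, b (n + i) x ∂(S.Qx T z) ≤ ∫ x, r ∂(S.Qx T z) := by
      refine integral_mono (integrable_finsetSum _ fun i _ => (hbc (n + i)).integrable _)
        (integrable_const _) fun x => ?_
      obtain ⟨j, hj⟩ := disj_index hd x
      by_cases hjn : ∃ i ∈ Finset.range N, n + i = j
      · obtain ⟨i, hi, rfl⟩ := hjn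
        simp only
        rw [Finset.sum_eq_single i]
        · exact hr _ _
        · intro k _ hk
          exact hj _ (by omega)
        · intro h; exact absurd hi h
      · simp only
        rw [Finset.sum_eq_zero]
        · exact hr0
        · intro i hi
          exact hj _ fun h => hjn ⟨i, hi, h⟩
    simpa using h1
  have := Finset.sum_le_sum (s := Finset.range N) fun i _ => hone i
  rw [Finset.sum_const, Finset.card_range, nsmul_eq_mul, Finset.sum_add_distrib] at this
  linarith

/-! ### Tightness -/

theorem finite_cover (ν : Measure X) [IsProbabilityMeasure ν] (A : Set X) {ε η : ℝ} (hε : 0 < ε)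
    (hη : 0 < η) : ∃ G : Finset X, (∀ a ∈ G, a ∈ A) ∧
      ν.real A - η ≤ ν.real (⋃ a ∈ G, ball a ε) := by
  classical
  have : SecondCountableTopology X := UniformSpace.secondCountable_of_separable X
  obtain ⟨t, htA, htc, hAt⟩ :=
    (TopologicalSpace.IsSeparable.of_separableSpace A).exists_countable_dense_subset
  rcases t.eq_empty_or_nonempty with rfl | hne
  · have : A = ∅ := by simpa using hAt
    refine ⟨∅, by simp, ?_⟩
    rw [this]
    simp [hη.le]
  obtain ⟨u, rfl⟩ := htc.exists_eq_range hne
  have hcov : A ⊆ ⋃ i, ball (u i) ε := by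
    intro x hx
    obtain ⟨_, ⟨i, rfl⟩, hi⟩ := Metric.mem_closure_iff.1 (hAt hx) ε hε
    exact mem_iUnion.2 ⟨i, hi⟩
  have h1 := tendsto_measure_iUnion_accumulate (μ := ν) (f := fun i => ball (u i) ε)
  have h2 := (ENNReal.tendsto_toReal (measure_ne_top ν _)).comp h1
  have h3 : ν.real A ≤ ν.real (⋃ i, ball (u i) ε) := measureReal_mono hcov
  have h4 : ν.real A - η < (ν (⋃ i, ball (u i) ε)).toReal := by
    change _ < ν.real _
    linarith
  obtain ⟨N, hN⟩ := (h2.eventually (lt_mem_nhds h4)).exists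
  refine ⟨(Finset.range (N + 1)).image u, ?_, ?_⟩
  · intro a ha
    obtain ⟨i, -, rfl⟩ := Finset.mem_image.1 ha
    exact htA ⟨i, rfl⟩
  · refine hN.le.trans (measureReal_mono (μ := ν) ?_ (measure_ne_top _ _))
    intro x hx
    obtain ⟨i, hi, hx⟩ := mem_accumulate.1 hx
    simp only [mem_iUnion]
    exact ⟨u i, Finset.mem_image.2 ⟨i, Finset.mem_range.2 (by omega), rfl⟩, hx⟩

theorem claimT (S : MarkovFellerSemigroup X) {z : X}
    (hz : S.CesaroEvContAt z)
    (hlow : ∀ ε > (0:ℝ), ∃ c > (0:ℝ), ∀ x : X,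
          c ≤ limsup (fun t => S.Qmeas t x (ball z ε)) atTop) {ε : ℝ} (hε : 0 < ε) :
    ∃ F : Finset X, ∀ᶠ n : ℕ in atTop, 1 - ε ≤ (S.Qx n z).real (⋃ y ∈ F, ball y ε) := by
  classical
  by_contra! hcon
  obtain ⟨f, hfP, hfr⟩ := exists_seq_of_forall_finset_exists
    (α := ℕ × Finset X)
    (fun p => 0 < p.1 ∧ ε / 2 ≤ (S.Qx p.1 z).real (⋃ a ∈ p.2, ball a (ε / 8)))
    (fun p q => p.1 < q.1 ∧ ∀ a ∈ p.2, ∀ b ∈ q.2, ε ≤ dist a b) (by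
      intro s _
      let F : Finset X := s.biUnion Prod.snd
      have hF := hcon F
      obtain ⟨n, hn, hn1⟩ := (hF.and_eventually (eventually_gt_atTop (s.sup Prod.fst))).exists
      have hn0 : 0 < n := lt_of_le_of_lt (Nat.zero_le _) hn1
      have := S.Qx_prob (T := n) (by exact_mod_cast hn0) z
      have hm : MeasurableSet (⋃ y ∈ F, ball y ε) :=
        (isOpen_biUnion fun _ _ => isOpen_ball).measurableSet
      obtain ⟨G, hG, hGm⟩ := finite_cover (S.Qx n z) (⋃ y ∈ F, ball y ε)ᶜ
        (ε := ε / 8) (η := ε / 2) (by positivity) (by positivity)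
      rw [probReal_compl_eq_one_sub hm] at hGm
      refine ⟨(n, G), ⟨hn0, ?_⟩, ?_⟩
      · simp only; linarith
      · intro p hp
        refine ⟨lt_of_le_of_lt (Finset.le_sup (f := Prod.fst) hp) hn1, fun a ha b hb => ?_⟩
        have hb' := hG b hb
        by_contra! hlt
        refine hb' ?_
        simp only [mem_iUnion]
        refine ⟨a, Finset.mem_biUnion.2 ⟨p, hp, ha⟩, ?_⟩
        rw [mem_ball, dist_comm]
        exact hlt)
  have hpos : ∀ i, (0:ℝ) < (f i).1 := fun i => by exact_mod_cast (hfP i).1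
  have hne : ∀ i, ((f i).2 : Set X).Nonempty := by
    intro i
    by_contra hemp
    have h1 := (hfP i).2
    rw [not_nonempty_iff_eq_empty, Finset.coe_eq_empty] at hemp
    rw [hemp] at h1
    simp at h1
    linarith
  let b : ℕ → X → ℝ := fun i y => max 0 (ε / 4 - infDist y ((f i).2 : Set X))
  have hb0 : ∀ i y, 0 ≤ b i y := fun i y => le_max_left _ _
  have hbr : ∀ i y, b i y ≤ ε / 4 := fun i y =>
    max_le (by positivity) (by linarith [infDist_nonneg (x := y) (s := ((f i).2 : Set X))])
  have hbl : ∀ i, LipschitzWith 1 (b i) := by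
    intro i
    refine LipschitzWith.of_le_add fun y y' => ?_
    have h1 := infDist_le_infDist_add_dist (x := y') (y := y) (s := ((f i).2 : Set X))
    rw [dist_comm] at h1
    have h2 : ε / 4 - infDist y' ((f i).2 : Set X) ≤ b i y' := le_max_right _ _
    refine max_le ?_ ?_
    · linarith [hb0 i y', dist_nonneg (x := y) (y := y')]
    · linarith
  have hnear : ∀ i y, b i y ≠ 0 → ∃ a ∈ (f i).2, dist y a < ε / 4 := by
    intro i y hy
    have h1 : 0 < b i y := lt_of_le_of_ne (hb0 i y) hy.symm
    have h2 : infDist y ((f i).2 : Set X) < ε / 4 := by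
      rcases lt_max_iff.1 h1 with h | h
      · exact absurd h (lt_irrefl _)
      · linarith
    obtain ⟨a, ha, hd⟩ := (infDist_lt_iff (hne i)).1 h2
    exact ⟨a, ha, hd⟩
  have hdlt : ∀ i j y, i < j → b i y = 0 ∨ b j y = 0 := by
    intro i j y hij
    by_contra! hc
    obtain ⟨a, ha, hda⟩ := hnear i y hc.1
    obtain ⟨a', ha', hda'⟩ := hnear j y hc.2
    have h1 := (hfr i j hij).2 a ha a' ha'
    have h2 := dist_triangle_left a a' y
    linarith
  have hbd : ∀ i j y, i ≠ j → b i y = 0 ∨ b j y = 0 := by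
    intro i j y hij
    rcases lt_or_gt_of_ne hij with h | h
    · exact hdlt i j y h
    · exact (hdlt j i y h).symm
  have hmono : StrictMono fun i => (f i).1 := fun i j hij => (hfr i j hij).1
  have hτ : Tendsto (fun i => ((f i).1 : ℝ)) atTop atTop :=
    tendsto_natCast_atTop_atTop.comp hmono.tendsto_atTop
  refine S.hump hz hlow hb0 hbr hbl hbd hpos hτ (κ := ε ^ 2 / 32) (by positivity) fun i => ?_
  have := S.Qx_prob (hpos i) z
  have hbi : BC (b i) (ε / 4) := ⟨(hbl i).continuous, fun y => by
    rw [abs_of_nonneg (hb0 i y)]; exact hbr i y⟩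
  rw [← S.integral_Qx hbi.1.measurable hbi.2 (hpos i)]
  have hm : MeasurableSet (⋃ a ∈ (f i).2, ball a (ε / 8)) :=
    (isOpen_biUnion fun _ _ => isOpen_ball).measurableSet
  have h1 : ∫ x, (⋃ a ∈ (f i).2, ball a (ε / 8)).indicator (fun _ => ε / 8) x ∂(S.Qx (f i).1 z)
      ≤ ∫ x, b i x ∂(S.Qx (f i).1 z) := by
    refine integral_mono ((integrable_const _).indicator hm) (hbi.integrable _) fun x => ?_
    by_cases hx : x ∈ ⋃ a ∈ (f i).2, ball a (ε / 8)
    · rw [indicator_of_mem hx]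
      simp only [mem_iUnion] at hx
      obtain ⟨a, ha, hxa⟩ := hx
      rw [mem_ball] at hxa
      have h2 := infDist_le_dist_of_mem (x := x) (Finset.mem_coe.2 ha)
      refine le_max_of_le_right ?_
      linarith
    · rw [indicator_of_notMem hx]; exact hb0 i x
  rw [integral_indicator_const _ hm, smul_eq_mul] at h1
  nlinarith [(hfP i).2]

theorem claimT' (S : MarkovFellerSemigroup X) {z : X}
    (hz : S.CesaroEvContAt z)
    (hlow : ∀ ε > (0:ℝ), ∃ c > (0:ℝ), ∀ x : X,
          c ≤ limsup (fun t => S.Qmeas t x (ball z ε)) atTop) {ε : ℝ} (hε : 0 < ε) :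
    ∃ F : Finset X, ∀ n : ℕ, 1 - ε ≤ (S.Qx (n + 1 : ℕ) z).real (⋃ y ∈ F, ball y ε) := by
  classical
  obtain ⟨F, hF⟩ := S.claimT hz hlow hε
  obtain ⟨N, hN⟩ := eventually_atTop.1 hF
  have hp : ∀ n : ℕ, IsProbabilityMeasure (S.Qx (n + 1 : ℕ) z) :=
    fun n => S.Qx_prob (by positivity) z
  have hG : ∀ n : ℕ, ∃ G : Finset X, 1 - ε ≤ (S.Qx (n + 1 : ℕ) z).real (⋃ y ∈ G, ball y ε) := by
    intro n
    have := hp n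
    obtain ⟨G, -, hG⟩ := finite_cover (S.Qx (n + 1 : ℕ) z) univ hε hε
    rw [probReal_univ] at hG
    exact ⟨G, hG⟩
  choose G hG using hG
  refine ⟨F ∪ (Finset.range N).biUnion G, fun n => ?_⟩
  have := hp n
  rcases lt_or_ge n N with h | h
  · refine (hG n).trans (measureReal_mono ?_ (measure_ne_top _ _))
    refine biUnion_subset_biUnion_left fun y hy => ?_
    exact Finset.mem_union_right _ (Finset.mem_biUnion.2 ⟨n, Finset.mem_range.2 h, hy⟩)
  · refine (hN (n + 1) (by omega)).trans (measureReal_mono ?_ (measure_ne_top _ _))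
    refine biUnion_subset_biUnion_left fun y hy => ?_
    exact Finset.mem_union_left _ hy

theorem tight_of (μ : ℕ → ProbabilityMeasure X)
    (h : ∀ ε > (0:ℝ), ∃ F : Finset X, ∀ n, 1 - ε ≤ (μ n : Measure X).real (⋃ y ∈ F, ball y ε)) :
    IsTightMeasureSet {((ν : ProbabilityMeasure X) : Measure X) | ν ∈ range μ} := by
  rw [isTightMeasureSet_iff_exists_isCompact_measure_compl_le]
  intro ε hε
  obtain ⟨e, he, hes⟩ := ENNReal.exists_pos_sum_of_countable hε.ne' ℕ
  let d : ℕ → ℝ := fun m => min (e m) (1 / ((m : ℝ) + 1))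
  have hd : ∀ m, 0 < d m := fun m => lt_min (by exact_mod_cast he m) (by positivity)
  choose F hF using fun m => h (d m) (hd m)
  let K : Set X := ⋂ m, ⋃ y ∈ F m, closedBall y (1 / ((m : ℝ) + 1))
  have hKc : IsClosed K := isClosed_iInter fun m =>
    (F m).finite_toSet.isClosed_biUnion fun _ _ => isClosed_closedBall
  refine ⟨K, TotallyBounded.isCompact_of_isClosed ?_ hKc, ?_⟩
  · refine Metric.totallyBounded_iff.2 fun δ hδ => ?_
    obtain ⟨m, hm⟩ := exists_nat_one_div_lt hδ
    refine ⟨F m, (F m).finite_toSet, (iInter_subset _ m).trans ?_⟩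
    refine iUnion₂_mono fun y _ => closedBall_subset_ball hm
  · rintro _ ⟨_, ⟨n, rfl⟩, rfl⟩
    calc (μ n : Measure X) Kᶜ
        = (μ n : Measure X) (⋃ m, (⋃ y ∈ F m, closedBall y (1 / ((m : ℝ) + 1)))ᶜ) := by
          rw [compl_iInter]
      _ ≤ ∑' m, (μ n : Measure X) (⋃ y ∈ F m, closedBall y (1 / ((m : ℝ) + 1)))ᶜ :=
          measure_iUnion_le _
      _ ≤ ∑' m, (e m : ℝ≥0∞) := by
          refine ENNReal.tsum_le_tsum fun m => ?_
          have hm : MeasurableSet (⋃ y ∈ F m, ball y (d m)) :=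
            (isOpen_biUnion fun _ _ => isOpen_ball).measurableSet
          have h1 : (μ n : Measure X).real (⋃ y ∈ F m, ball y (d m))ᶜ ≤ e m := by
            rw [probReal_compl_eq_one_sub hm]
            have := hF m n
            have : d m ≤ e m := min_le_left _ _
            linarith
          have h2 : (μ n : Measure X) (⋃ y ∈ F m, ball y (d m))ᶜ ≤ e m := by
            rw [← ofReal_measureReal, ← ENNReal.ofReal_coe_nnreal]
            exact ENNReal.ofReal_le_ofReal h1
          refine (measure_mono ?_).trans h2
          refine compl_subset_compl.2 (iUnion₂_mono fun y _ => ?_)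
          exact ball_subset_closedBall.trans (closedBall_subset_closedBall (min_le_right _ _))
      _ ≤ ε := hes.le

/-! ### Conclusion -/

theorem bcf_BC (f : BoundedContinuousFunction X ℝ) : BC f ‖f‖ :=
  ⟨f.continuous, fun x => f.norm_coe_le_norm x⟩

theorem Pmeas_prob (S : MarkovFellerSemigroup X) (ν : Measure X) [IsProbabilityMeasure ν] {s : ℝ}
    (hs : 0 ≤ s) : IsProbabilityMeasure (S.Pmeas s ν) := by
  let κ : ProbabilityTheory.Kernel X X := ⟨S.P s, S.measurable_x s hs⟩
  have hκ : ProbabilityTheory.IsMarkovKernel κ := ⟨fun y => S.isProb s hs y⟩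
  change IsProbabilityMeasure (ν.bind κ)
  infer_instance

theorem integral_Pmeas (S : MarkovFellerSemigroup X) (ν : Measure X) [IsProbabilityMeasure ν]
    {f : X → ℝ} {M : ℝ} (h : BC f M) {s : ℝ} (hs : 0 ≤ s) :
    ∫ x, f x ∂(S.Pmeas s ν) = ∫ x, S.Pf s f x ∂ν := by
  let κ : ProbabilityTheory.Kernel X X := ⟨S.P s, S.measurable_x s hs⟩
  have hκ : ProbabilityTheory.IsMarkovKernel κ := ⟨fun y => S.isProb s hs y⟩
  have := S.Pmeas_prob ν hs
  have hb : S.Pmeas s ν = ν.bind κ := rfl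
  have hi := h.integrable (S.Pmeas s ν)
  rw [hb] at hi
  rw [hb, aux_integral_bind _ _ hi]
  rfl

theorem QfM_inv (S : MarkovFellerSemigroup X) {ν : Measure X} (hν : S.Invariant ν)
    {f : X → ℝ} {M : ℝ} (h : BC f M) {T : ℝ} (hT : 0 < T) :
    S.QfM T f ν = ∫ x, f x ∂ν := by
  have := hν.1
  have e : ∫ s in (0:ℝ)..T, ∫ x, S.Pf s f x ∂ν = ∫ s in (0:ℝ)..T, ∫ x, f x ∂ν := by
    refine intervalIntegral.integral_congr fun s hs => ?_
    rw [uIcc_of_le hT.le] at hs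
    change ∫ x, S.Pf s f x ∂ν = ∫ x, f x ∂ν
    rw [← S.integral_Pmeas ν h hs.1, hν.2 s hs.1]
  rw [QfM, e, intervalIntegral.integral_const, smul_eq_mul, sub_zero]
  field_simp

theorem exists_inv (S : MarkovFellerSemigroup X) {z : X}
    (hz : S.CesaroEvContAt z)
    (hlow : ∀ ε > (0:ℝ), ∃ c > (0:ℝ), ∀ x : X,
          c ≤ limsup (fun t => S.Qmeas t x (ball z ε)) atTop) : ∃ μ, S.Invariant μ := by
  have hpos : ∀ n : ℕ, (0:ℝ) < (n + 1 : ℕ) := fun n => by positivity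
  let m : ℕ → ProbabilityMeasure X := fun n => ⟨S.Qx (n + 1 : ℕ) z, S.Qx_prob (hpos n) z⟩
  have hm : ∀ n, (m n : Measure X) = S.Qx (n + 1 : ℕ) z := fun n => rfl
  have htight := tight_of m fun ε hε => S.claimT' hz hlow hε
  have hcomp := isCompact_closure_of_isTightMeasureSet htight
  let U : Ultrafilter ℕ := Ultrafilter.of atTop
  have hU : (U : Filter ℕ) ≤ atTop := Ultrafilter.of_le atTop
  obtain ⟨μ, -, hμ⟩ := hcomp.ultrafilter_le_nhds (U.map m) (by
    rw [le_principal_iff]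
    exact mem_map.2 (univ_mem' fun n => subset_closure ⟨n, rfl⟩))
  have hμt : Tendsto m U (𝓝 μ) := hμ
  rw [ProbabilityMeasure.tendsto_iff_forall_integral_tendsto] at hμt
  have hlim : ∀ {f : X → ℝ} {M : ℝ} (h : BC f M),
      Tendsto (fun n : ℕ => S.Qf (n + 1 : ℕ) f z) U (𝓝 (∫ x, f x ∂(μ : Measure X))) := by
    intro f M h
    refine (hμt h.bcf).congr fun n => ?_
    rw [hm]
    exact S.integral_Qx h.1.measurable h.2 (hpos n) z
  refine ⟨μ, inferInstance, fun s hs => ?_⟩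
  have := S.Pmeas_prob (μ : Measure X) hs
  refine ext_of_forall_integral_eq_of_IsFiniteMeasure fun f => ?_
  have hf := bcf_BC f
  rw [S.integral_Pmeas _ hf hs]
  have h1 := (hlim (S.BC_Pf hf hs)).sub (hlim hf)
  have h2 : Tendsto (fun n : ℕ => S.Qf (n + 1 : ℕ) (S.Pf s f) z - S.Qf (n + 1 : ℕ) f z) U (𝓝 0) := by
    refine squeeze_zero_norm (a := fun n : ℕ => 2 * s * ‖f‖ / (n + 1 : ℕ))
      (fun n => S.Qf_Pf_est hf hs (hpos n) z) ?_
    have h3 : Tendsto (fun n : ℕ => ((n + 1 : ℕ) : ℝ)) atTop atTop :=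
      tendsto_natCast_atTop_atTop.comp (tendsto_add_atTop_nat 1)
    exact (h3.const_div_atTop _).mono_left hU
  exact sub_eq_zero.1 (tendsto_nhds_unique h1 h2)

theorem back (S : MarkovFellerSemigroup X) {z : X}
    (hz : S.CesaroEvContAt z)
    (hlow : ∀ ε > (0:ℝ), ∃ c > (0:ℝ), ∀ x : X,
          c ≤ limsup (fun t => S.Qmeas t x (ball z ε)) atTop) : S.WeakStarMeanErgodic := by
  obtain ⟨μ, hμ⟩ := S.exists_inv hz hlow
  have hμp := hμ.1
  have hdct : ∀ ν : Measure X, IsProbabilityMeasure ν → ∀ f : X → ℝ, IsBddLipschitz f →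
      Tendsto (fun t => S.QfM t f ν - S.Qf t f z) atTop (𝓝 0) := by
    intro ν hν f hf
    obtain ⟨M, h⟩ := hf.exBC
    have h1 : Tendsto (fun t => ∫ x, (S.Qf t f x - S.Qf t f z) ∂ν) atTop (𝓝 (∫ x, (0:ℝ) ∂ν)) := by
      refine tendsto_integral_filter_of_dominated_convergence (fun _ => 2 * M) ?_ ?_
        (integrable_const _) (Eventually.of_forall fun x => S.merging hz hlow hf x)
      · filter_upwards [eventually_gt_atTop 0] with t ht
        exact ((S.BC_Qf h ht).1.sub continuous_const).measurable.aestronglyMeasurable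
      · filter_upwards [eventually_gt_atTop 0] with t ht
        exact Eventually.of_forall fun x => S.Qdiff_bound h x z ht
    rw [integral_zero] at h1
    refine h1.congr' ?_
    filter_upwards [eventually_gt_atTop 0] with t ht
    rw [integral_sub ((S.BC_Qf h ht).integrable ν) (integrable_const _),
      ← S.QfM_eq h.1.measurable h.2 ht]
    simp
  have hlip : ∀ ν : Measure X, IsProbabilityMeasure ν → ∀ f : X → ℝ, IsBddLipschitz f →
      Tendsto (fun t => S.QfM t f ν) atTop (𝓝 (∫ x, f x ∂μ)) := by
    intro ν hν f hf
    obtain ⟨M, h⟩ := hf.exBC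
    have h1 := ((hdct ν hν f hf).sub (hdct μ hμp f hf)).add_const (∫ x, f x ∂μ)
    simp only [sub_zero, zero_add] at h1
    refine h1.congr' ?_
    filter_upwards [eventually_gt_atTop 0] with t ht
    rw [S.QfM_inv hμ h ht]
    ring
  have hconv : ∀ ν : Measure X, IsProbabilityMeasure ν → S.QWeakLimM ν μ := by
    intro ν hν f
    have hpos : ∀ t : ℝ, 0 < max t 1 := fun t => lt_of_lt_of_le one_pos (le_max_right _ _)
    have hev : ∀ᶠ t : ℝ in atTop, max t 1 = t := by
      filter_upwards [eventually_ge_atTop 1] with t ht using max_eq_left ht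
    let q : ℝ → ProbabilityMeasure X := fun t => ⟨S.QM (max t 1) ν, S.QM_prob (hpos t) ν⟩
    let μP : ProbabilityMeasure X := ⟨μ, hμp⟩
    have hq : Tendsto q atTop (𝓝 μP) := by
      rw [tendsto_iff_forall_lipschitz_integral_tendsto]
      rintro g ⟨C, hC⟩ ⟨K, hK⟩
      have hg : IsBddLipschitz g := by
        refine ⟨⟨K, hK⟩, |g z| + C, fun x => ?_⟩
        have h1 := hC x z
        rw [Real.dist_eq] at h1
        have h2 := abs_sub_abs_le_abs_sub (g x) (g z)
        linarith
      obtain ⟨M, h⟩ := hg.exBC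
      refine (hlip ν hν g hg).congr' ?_
      filter_upwards [hev] with t ht
      change _ = ∫ x, g x ∂(S.QM (max t 1) ν)
      rw [S.integral_QM h.1.measurable h.2 (hpos t), ht]
    rw [ProbabilityMeasure.tendsto_iff_forall_integral_tendsto] at hq
    refine (hq f).congr' ?_
    filter_upwards [hev] with t ht
    change ∫ x, f x ∂(S.QM (max t 1) ν) = _
    rw [S.integral_QM (bcf_BC f).1.measurable (bcf_BC f).2 (hpos t), ht]
  refine ⟨μ, hμ, fun ν hν => ?_, hconv⟩
  have hνp := hν.1
  refine ext_of_forall_integral_eq_of_IsFiniteMeasure fun f => ?_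
  refine tendsto_nhds_unique (f := fun t => S.QfM t f ν) (l := atTop) ?_ (hconv ν hνp f)
  refine tendsto_const_nhds.congr' ?_
  filter_upwards [eventually_gt_atTop 0] with t ht
  exact (S.QfM_inv hν (bcf_BC f) ht).symm

theorem forth (S : MarkovFellerSemigroup X) (hS : S.WeakStarMeanErgodic) :
      ((∀ z : X, S.CesaroEvContAt z) ∧
        ∃ z : X, ∀ ε > (0:ℝ), ∃ c > (0:ℝ), ∀ x : X,
          c ≤ limsup (fun t => S.Qmeas t x (ball z ε)) atTop) := by
  obtain ⟨μ, hμ, -, hconv⟩ := hS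
  have hμp := hμ.1
  have hpt : ∀ {f : X → ℝ} {M : ℝ} (h : BC f M) (x : X),
      Tendsto (fun t => S.Qf t f x) atTop (𝓝 (∫ y, f y ∂μ)) := by
    intro f M h x
    refine (hconv (Measure.dirac x) inferInstance h.bcf).congr' ?_
    filter_upwards [eventually_gt_atTop 0] with t ht
    exact S.QfM_dirac h.1.measurable h.2 ht x
  refine ⟨fun z f hf => ?_, ?_⟩
  · obtain ⟨M, h⟩ := hf.exBC
    have e : ∀ x, limsup (fun t => |S.Qf t f x - S.Qf t f z|) atTop = 0 := by
      intro x
      have h1 := ((hpt h x).sub (hpt h z)).abs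
      rw [sub_self, abs_zero] at h1
      exact h1.limsup_eq
    simp_rw [e]
    exact limsup_const 0
  · have : SecondCountableTopology X := UniformSpace.secondCountable_of_separable X
    obtain ⟨z, -, hz⟩ := exists_mem_forall_mem_nhdsWithin_pos_measure (μ := μ) (s := univ)
      (by rw [measure_univ]; exact one_ne_zero)
    refine ⟨z, fun ε hε => ?_⟩
    have hball : 0 < μ (ball z ε) :=
      hz _ (mem_nhdsWithin_of_mem_nhds (ball_mem_nhds z hε))
    refine ⟨_, hat_integral_pos z hε μ hball, fun x => ?_⟩
    have hh := hat_BC z hε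
    have h1 := hpt hh x
    rw [← h1.limsup_eq]
    refine limsup_le_limsup ?_ h1.isBoundedUnder_ge.isCoboundedUnder_le ?_
    · filter_upwards [eventually_gt_atTop 0] with t ht
      have := S.Qx_prob ht x
      rw [S.Qmeas_eq measurableSet_ball ht, ← S.integral_Qx hh.1.measurable hh.2 ht,
        ← integral_indicator_one measurableSet_ball]
      refine integral_mono (hh.integrable _)
        ((integrable_const (1:ℝ)).indicator measurableSet_ball) fun y => ?_
      by_cases hy : y ∈ ball z ε
      · rw [indicator_of_mem hy]; exact hat_le_one z hε y
      · rw [indicator_of_notMem hy, hat_zero z hε hy]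
    · refine isBoundedUnder_of_eventually_le (a := 1) ?_
      filter_upwards [eventually_gt_atTop 0] with t ht
      have := S.Qx_prob ht x
      rw [S.Qmeas_eq measurableSet_ball ht]
      exact measureReal_le_one

theorem weakStarMeanErgodic_iff_cesaroEvCont_and_lower_bound
    (S : MarkovFellerSemigroup X) :
    S.WeakStarMeanErgodic ↔
      ((∀ z : X, S.CesaroEvContAt z) ∧
        ∃ z : X, ∀ ε > (0:ℝ), ∃ c > (0:ℝ), ∀ x : X,
          c ≤ limsup (fun t => S.Qmeas t x (ball z ε)) atTop) := by
  refine ⟨fun h => S.forth h, fun h => ?_⟩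
  obtain ⟨hz, z, hlow⟩ := h
  exact S.back (hz z) hlow

end MarkovFellerSemigroup
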